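/- Every finite connected regular chordal graph is a complete graph. -/

import Mathlib

open SimpleGraph

/-- The signless Laplacian matrix `Q(G) = D(G) + A(G)` of a finite simple graph. -/
noncomputable def signlessLaplacian {V : Type*} [Fintype V] (G : SimpleGraph V) :
    Matrix V V ℝ :=
  letI := Classical.decEq V
  letI := Classical.decRel G.Adj
  Matrix.diagonal (fun v => (G.degree v : ℝ)) + G.adjMatrix ℝ

/-- `q` is a main Q-eigenvalue of `G`: some eigenvector of `Q(G)` for `q`
has nonzero entry sum. -/
def IsMainQEigenvalue {V : Type*} [Fintype V] (G : SimpleGraph V) (q : ℝ) : Prop :=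
  ∃ x : V → ℝ, (signlessLaplacian G).mulVec x = q • x ∧ (∑ v, x v) ≠ 0

/-- The number of (distinct) main Q-eigenvalues of `G`. -/
noncomputable def mainQCount {V : Type*} [Fintype V] (G : SimpleGraph V) : ℕ :=
  {q : ℝ | IsMainQEigenvalue G q}.ncard

/-- `G` contains an induced copy of `H`. -/
def HasInducedCopy {α β : Type*} (H : SimpleGraph α) (G : SimpleGraph β) : Prop :=
  ∃ f : α ↪ β, ∀ a b : α, H.Adj a b ↔ G.Adj (f a) (f b)

/-- A cograph is a `P₄`-free graph. -/
def IsCograph {V : Type*} (G : SimpleGraph V) : Prop :=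
  ¬ HasInducedCopy (SimpleGraph.pathGraph 4) G

/-- A quasi-threshold graph is a `{P₄, C₄}`-free graph. -/
def IsQuasiThreshold {V : Type*} (G : SimpleGraph V) : Prop :=
  ¬ HasInducedCopy (SimpleGraph.pathGraph 4) G ∧
  ¬ HasInducedCopy (SimpleGraph.cycleGraph 4) G

/-- A chordal graph: no induced cycle of length at least 4. -/
def IsChordal {V : Type*} (G : SimpleGraph V) : Prop :=
  ∀ n : ℕ, 4 ≤ n → ¬ HasInducedCopy (SimpleGraph.cycleGraph n) G

/-- The join `G ⊕ H` of two vertex-disjoint graphs. -/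
def graphJoin {V W : Type*} (G : SimpleGraph V) (H : SimpleGraph W) :
    SimpleGraph (V ⊕ W) where
  Adj x y :=
    match x, y with
    | Sum.inl a, Sum.inl b => G.Adj a b
    | Sum.inr a, Sum.inr b => H.Adj a b
    | Sum.inl _, Sum.inr _ => True
    | Sum.inr _, Sum.inl _ => True
  symm := by
    refine ⟨?_⟩
    rintro (a | a) (b | b) h
    · exact G.symm.symm a b h
    · trivial
    · trivial
    · exact H.symm.symm a b h
  loopless := by
    refine ⟨?_⟩
    rintro (a | a) h
    · exact G.loopless.irrefl a h
    · exact H.loopless.irrefl a h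

/-- The disjoint union `G ∪ H` of two vertex-disjoint graphs. -/
def disjUnionGraph {V W : Type*} (G : SimpleGraph V) (H : SimpleGraph W) :
    SimpleGraph (V ⊕ W) where
  Adj x y :=
    match x, y with
    | Sum.inl a, Sum.inl b => G.Adj a b
    | Sum.inr a, Sum.inr b => H.Adj a b
    | _, _ => False
  symm := by
    refine ⟨?_⟩
    rintro (a | a) (b | b) h
    · exact G.symm.symm a b h
    · exact h.elim
    · exact h.elim
    · exact H.symm.symm a b h
  loopless := by
    refine ⟨?_⟩
    rintro (a | a) h
    · exact G.loopless.irrefl a h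
    · exact H.loopless.irrefl a h

/-- `tK_a`: the disjoint union of `t` copies of the complete graph `K_a`. -/
def copiesComplete (t a : ℕ) : SimpleGraph (Fin t × Fin a) where
  Adj x y := x.1 = y.1 ∧ x.2 ≠ y.2
  symm := ⟨fun _ _ ⟨h1, h2⟩ => ⟨h1.symm, h2.symm⟩⟩
  loopless := ⟨fun _ ⟨_, h⟩ => h rfl⟩

/-- The disjoint union `a₁ K_{n₁} ∪ ⋯ ∪ a_p K_{n_p}`: for each `i : Fin p`,
`a i` copies of the complete graph on `n i` vertices. Two vertices are adjacent
iff they lie in the same copy of the same complete graph and are distinct. -/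
def satellites (p : ℕ) (a n : Fin p → ℕ) :
    SimpleGraph ((i : Fin p) × (Fin (a i) × Fin (n i))) where
  Adj x y := x.1 = y.1 ∧ HEq x.2.1 y.2.1 ∧ ¬ HEq x.2.2 y.2.2
  symm := ⟨fun _ _ ⟨h1, h2, h3⟩ => ⟨h1.symm, h2.symm, fun h => h3 h.symm⟩⟩
  loopless := ⟨fun _ ⟨_, _, h3⟩ => h3 HEq.rfl⟩

theorem chordal_no_cycle {V : Type*} {G : SimpleGraph V} (hG : IsChordal G) (m : ℕ) (hm : 2 ≤ m)
    (p : ℕ → V) (v : V)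
    (h : ∀ i j, i < j → j ≤ m → p i ≠ p j ∧ (G.Adj (p i) (p j) ↔ j = i + 1))
    (hv : ∀ i, i ≤ m → p i ≠ v ∧ (G.Adj (p i) v ↔ (i = 0 ∨ i = m))) : False := by
  have key : ∀ a b : Fin (m + 2), a < b →
      (if a.val ≤ m then p a.val else v) ≠ (if b.val ≤ m then p b.val else v) ∧
      ((cycleGraph (m + 2)).Adj a b ↔
        G.Adj (if a.val ≤ m then p a.val else v) (if b.val ≤ m then p b.val else v)) := by
    intro a b hab
    have hab' : a.val < b.val := hab
    have ha : a.val ≤ m := by have := b.isLt; omega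
    rw [if_pos ha, cycleGraph_adj', Fin.coe_sub_iff_lt.mpr hab, Fin.coe_sub_iff_le.mpr hab.le]
    have hb2 := b.isLt
    by_cases hb : b.val ≤ m
    · rw [if_pos hb]
      obtain ⟨h1, h2⟩ := h a b hab' hb
      refine ⟨h1, ?_⟩
      rw [h2]
      omega
    · rw [if_neg hb]
      obtain ⟨h1, h2⟩ := hv a ha
      refine ⟨h1, ?_⟩
      rw [h2]
      omega
  refine hG (m + 2) (by omega) ⟨⟨fun i => if i.val ≤ m then p i.val else v, ?_⟩, ?_⟩
  · intro a b hab
    rcases lt_trichotomy a b with hl | hl | hl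
    · exact absurd hab (key a b hl).1
    · exact hl
    · exact absurd hab.symm (key b a hl).1
  · intro a b
    rcases lt_trichotomy a b with hl | hl | hl
    · exact (key a b hl).2
    · subst hl
      simp
    · rw [SimpleGraph.adj_comm, G.adj_comm]
      exact (key b a hl).2

/-- Edges of `G` inside `C`. -/
def onSet {V : Type*} (G : SimpleGraph V) (C : Set V) : SimpleGraph V where
  Adj a b := G.Adj a b ∧ a ∈ C ∧ b ∈ C
  symm := ⟨fun _ _ h => ⟨h.1.symm, h.2.2, h.2.1⟩⟩
  loopless := ⟨fun _ h => G.loopless.irrefl _ h.1⟩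

theorem onSet_mono {V : Type*} (G : SimpleGraph V) {C D : Set V} (h : C ⊆ D) :
    onSet G C ≤ onSet G D := fun _ _ hab => ⟨hab.1, h hab.2.1, h hab.2.2⟩

theorem sep_clique {V : Type*} {G : SimpleGraph V} (hG : IsChordal G) (C : Set V)
    (hC : ∀ a ∈ C, ∀ b ∈ C, (onSet G C).Reachable a b)
    (x y v a b : V) (hvC : v ∉ C) (hvn : ∀ c ∈ C, ¬ G.Adj c v)
    (hxv : G.Adj x v) (hyv : G.Adj y v)
    (ha : a ∈ C) (hxa : G.Adj x a) (hb : b ∈ C) (hyb : G.Adj y b) (hxy : x ≠ y) :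
    G.Adj x y := by
  by_contra hn
  set D : Set V := insert x (insert y C) with hD
  have hCD : C ⊆ D := fun c hc => by simp [hD, hc]
  have hxD : x ∈ D := by simp [hD]
  have hyD : y ∈ D := by simp [hD]
  have hr : (onSet G D).Reachable x y := by
    have h1 : (onSet G D).Adj x a := ⟨hxa, hxD, hCD ha⟩
    have h2 : (onSet G D).Adj b y := ⟨hyb.symm, hCD hb, hyD⟩
    exact h1.reachable.trans (((hC a ha b hb).mono (onSet_mono G hCD)).trans h2.reachable)
  obtain ⟨p, hp⟩ := hr.exists_walk_length_eq_dist
  have hsh : ∀ q : (onSet G D).Walk x y, p.length ≤ q.length := fun q => hp ▸ dist_le q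
  have hpos : p.length ≠ 0 := fun h => hxy (Walk.eq_of_length_eq_zero h)
  have hmem : ∀ i, i ≤ p.length → p.getVert i ∈ D := by
    intro i hi
    rcases hi.lt_or_eq with h | h
    · exact (p.adj_getVert_succ h).2.1
    · rw [h, Walk.getVert_length]; exact hyD
  have hne : ∀ i j, i < j → j ≤ p.length → p.getVert i ≠ p.getVert j := by
    intro i j hij hj he
    have := hsh ((p.take i).append ((p.drop j).copy he.symm rfl))
    simp only [Walk.length_append, Walk.length_copy, Walk.take_length, Walk.drop_length] at this
    omega
  have hadj : ∀ i j, i < j → j ≤ p.length → 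
      (G.Adj (p.getVert i) (p.getVert j) ↔ j = i + 1) := by
    intro i j hij hj
    constructor
    · intro h
      have h' : (onSet G D).Adj (p.getVert i) (p.getVert j) :=
        ⟨h, hmem i (by omega), hmem j hj⟩
      have := hsh ((p.take i).append (Walk.cons h' (p.drop j)))
      simp only [Walk.length_append, Walk.length_cons, Walk.take_length, Walk.drop_length] at this
      omega
    · rintro rfl
      exact (p.adj_getVert_succ (by omega)).1
  have h2 : 2 ≤ p.length := by
    by_contra hlt
    have h1 : p.length = 1 := by omega
    have := (hadj 0 p.length (by omega) le_rfl).2 (by omega)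
    rw [Walk.getVert_length, Walk.getVert_zero] at this
    exact hn this
  refine chordal_no_cycle hG p.length h2 p.getVert v
    (fun i j hij hj => ⟨hne i j hij hj, hadj i j hij hj⟩) ?_
  intro i hi
  by_cases h0 : i = 0
  · subst h0
    simpa using ⟨hxv.ne, hxv⟩
  by_cases hl : i = p.length
  · subst hl
    simpa using ⟨hyv.ne, hyv⟩
  have hx' : p.getVert i ≠ x := by
    have := hne 0 i (by omega) hi
    rw [Walk.getVert_zero] at this
    exact this.symm
  have hy' : p.getVert i ≠ y := by
    have := hne i p.length (by omega) le_rfl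
    rwa [Walk.getVert_length] at this
  have hc : p.getVert i ∈ C := by
    have := hmem i hi
    simpa [hD, hx', hy'] using this
  refine ⟨fun h => hvC (h ▸ hc), ?_⟩
  simp only [h0, hl, or_self, iff_false]
  exact hvn _ hc

theorem exists_simplicial {V : Type*} [Fintype V] {G : SimpleGraph V} (hG : IsChordal G) :
    ∀ (n : ℕ) (A : Finset V), A.card = n → A.Nonempty →
      ∃ v ∈ A, ∀ x ∈ A, ∀ y ∈ A, G.Adj v x → G.Adj v y → x ≠ y → G.Adj x y := by
  classical
  intro n
  induction n using Nat.strong_induction_on with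
  | _ n ih =>
  intro A hA hne
  let P : Finset V → Prop := fun C => C.Nonempty ∧ C ⊆ A ∧
    (∀ a ∈ C, ∀ b ∈ C, (onSet G (C : Set V)).Reachable a b) ∧
    ∃ v ∈ A, v ∉ C ∧ ∀ c ∈ C, ¬ G.Adj c v
  by_cases hP : ∃ C, P C
  · obtain ⟨C, hC, hmax⟩ := Finset.exists_max_image (Finset.univ.filter P) Finset.card
      (by obtain ⟨C, hC⟩ := hP; exact ⟨C, by simpa using hC⟩)
    obtain ⟨-, hC⟩ := Finset.mem_filter.1 hC
    obtain ⟨⟨c0, hc0⟩, hCA, hcon, v0, hv0A, hv0C, hv0⟩ := hC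
    -- vertices far from `C` are complete to the neighbourhood of `C`
    have hcomp : ∀ v ∈ A, v ∉ C → (∀ c ∈ C, ¬ G.Adj c v) →
        ∀ s ∈ A, s ∉ C → ∀ c ∈ C, G.Adj s c → G.Adj s v := by
      intro v hvA hvC hv s hsA hsC c hc hsc
      by_contra hsv
      have hPs : P (insert s C) := by
        have hsub : (C : Set V) ⊆ ((insert s C : Finset V) : Set V) := by simp
        have hr : ∀ a ∈ C, (onSet G ((insert s C : Finset V) : Set V)).Reachable s a := by
          intro a ha
          have h1 : (onSet G ((insert s C : Finset V) : Set V)).Adj s c :=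
            ⟨hsc, by simp, by simp [hc]⟩
          exact h1.reachable.trans ((hcon c hc a ha).mono (onSet_mono G hsub))
        refine ⟨⟨s, by simp⟩, ?_, ?_, v, hvA, ?_, ?_⟩
        · exact Finset.insert_subset hsA hCA
        · intro a ha b hb
          rcases Finset.mem_insert.1 ha with rfl | ha'
          · rcases Finset.mem_insert.1 hb with rfl | hb'
            · exact Reachable.refl _
            · exact hr b hb'
          · rcases Finset.mem_insert.1 hb with rfl | hb'
            · exact (hr a ha').symm
            · exact (hcon a ha' b hb').mono (onSet_mono G hsub)
        · intro hmem
          rcases Finset.mem_insert.1 hmem with rfl | h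
          · exact hv c hc hsc.symm
          · exact hvC h
        · intro d hd
          rcases Finset.mem_insert.1 hd with rfl | h
          · exact hsv
          · exact hv d h
      have := hmax (insert s C) (by simpa using hPs)
      rw [Finset.card_insert_of_notMem hsC] at this
      omega
    let D := A.filter (fun v => v ∉ C ∧ ∀ c ∈ C, ¬ G.Adj c v)
    have hDlt : D.card < n := by
      rw [← hA]
      refine Finset.card_lt_card ((Finset.ssubset_iff_of_subset (Finset.filter_subset _ _)).2
        ⟨c0, hCA hc0, ?_⟩)
      intro h
      exact (Finset.mem_filter.1 h).2.1 hc0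
    obtain ⟨w, hwD, hw⟩ := ih D.card hDlt D rfl
      ⟨v0, Finset.mem_filter.2 ⟨hv0A, hv0C, hv0⟩⟩
    obtain ⟨hwA, hwC, hwn⟩ := Finset.mem_filter.1 hwD
    have hcase : ∀ x ∈ A, G.Adj w x → x ∈ D ∨ (x ∉ C ∧ ∃ c ∈ C, G.Adj x c) := by
      intro x hx hwx
      have hxC : x ∉ C := fun h => hwn x h hwx.symm
      by_cases h : ∀ c ∈ C, ¬ G.Adj c x
      · exact Or.inl (Finset.mem_filter.2 ⟨hx, hxC, h⟩)
      · push Not at h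
        obtain ⟨c, hc, hcx⟩ := h
        exact Or.inr ⟨hxC, c, hc, hcx.symm⟩
    refine ⟨w, hwA, ?_⟩
    intro x hx y hy hwx hwy hxy
    rcases hcase x hx hwx with h1 | ⟨h1, c, hc, hxc⟩
    · rcases hcase y hy hwy with h2 | ⟨h2, d, hd, hyd⟩
      · exact hw x h1 y h2 hwx hwy hxy
      · obtain ⟨_, hxC, hxn⟩ := Finset.mem_filter.1 h1
        exact (hcomp x hx hxC hxn y hy h2 d hd hyd).symm
    · rcases hcase y hy hwy with h2 | ⟨h2, d, hd, hyd⟩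
      · obtain ⟨_, hyC, hyn⟩ := Finset.mem_filter.1 h2
        exact hcomp y hy hyC hyn x hx h1 c hc hxc
      · exact sep_clique hG (C : Set V) hcon x y w c d hwC hwn hwx.symm hwy.symm
          hc hxc hd hyd hxy
  · obtain ⟨v, hv⟩ := hne
    refine ⟨v, hv, ?_⟩
    intro x hx y hy _ _ hxy
    by_contra hn
    refine hP ⟨{x}, ⟨x, by simp⟩, by simpa using hx, ?_, y, hy, by simpa using hxy.symm, ?_⟩
    · intro a ha b hb
      rw [Finset.mem_singleton] at ha hb
      subst ha; subst hb
      exact Reachable.refl _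
    · intro c hc
      rw [Finset.mem_singleton] at hc
      subst hc
      exact hn

theorem regular_connected_chordal_is_complete
    {V : Type*} [Fintype V] (G : SimpleGraph V) [DecidableRel G.Adj]
    (hconn : G.Connected)
    (hreg : ∃ d : ℕ, ∀ v : V, G.degree v = d)
    (hchordal : IsChordal G) :
    G = ⊤ := by
  classical
  obtain ⟨d, hd⟩ := hreg
  obtain ⟨v0⟩ := hconn.nonempty
  obtain ⟨v, -, hv⟩ := exists_simplicial hchordal _ Finset.univ rfl ⟨v0, Finset.mem_univ _⟩
  -- the closed neighbourhood of `v` is closed under adjacency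
  have hstep : ∀ u w, (u = v ∨ G.Adj v u) → G.Adj u w → (w = v ∨ G.Adj v w) := by
    intro u w hu huw
    rcases hu with rfl | hu
    · exact Or.inr huw
    have hsub : insert v ((G.neighborFinset v).erase u) ⊆ G.neighborFinset u := by
      intro z hz
      rw [mem_neighborFinset]
      rcases Finset.mem_insert.1 hz with rfl | hz
      · exact hu.symm
      · obtain ⟨hzu, hz⟩ := Finset.mem_erase.1 hz
        rw [mem_neighborFinset] at hz
        exact hv u (Finset.mem_univ _) z (Finset.mem_univ _) hu hz hzu.symm
    have hcard : (G.neighborFinset u).card ≤ (insert v ((G.neighborFinset v).erase u)).card := by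
      rw [Finset.card_insert_of_notMem (by simp), Finset.card_erase_of_mem (by simpa using hu),
        card_neighborFinset_eq_degree, card_neighborFinset_eq_degree, hd, hd]
      omega
    have heq := Finset.eq_of_subset_of_card_le hsub hcard
    have hw : w ∈ insert v ((G.neighborFinset v).erase u) := by
      rw [heq, mem_neighborFinset]; exact huw
    rcases Finset.mem_insert.1 hw with h | h
    · exact Or.inl h
    · exact Or.inr (by simpa using (Finset.mem_erase.1 h).2)
  have hwalk : ∀ a b : V, G.Walk a b → (a = v ∨ G.Adj v a) → (b = v ∨ G.Adj v b) := by
    intro a b p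
    induction p with
    | nil => exact id
    | cons h _ ih => exact fun ha => ih (hstep _ _ ha h)
  have hall : ∀ b, b = v ∨ G.Adj v b := by
    intro b
    obtain ⟨p⟩ := hconn.preconnected v b
    exact hwalk v b p (Or.inl rfl)
  ext a b
  rw [top_adj]
  refine ⟨fun h => h.ne, fun hab => ?_⟩
  rcases hall a with rfl | ha
  · rcases hall b with rfl | hb
    · exact absurd rfl hab
    · exact hb
  · rcases hall b with rfl | hb
    · exact ha.symm
    · exact hv a (Finset.mem_univ _) b (Finset.mem_univ _) ha hb hab
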